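/- Let X be a real m × n matrix, let Z₁, Z₂, Z₃, Y₁, Y₂, Y₃ be real n × n matrices, and let μ > 0. Define g(W) = (1/2)‖X − XW‖_F² + (μ/2)[‖Z₁ − (W − Y₁/μ)‖_F² + ‖Z₂ − (W − Y₂/μ)‖_F² + ‖Z₃ − (W − Y₃/μ)‖_F²]. Then W* = (3μI + XᵀX)⁻¹ [μ(Z₁ + Z₂ + Z₃) + (Y₁ + Y₂ + Y₃) + XᵀX] is the unique global minimizer of g over all real n × n matrices W: for every W ≠ W*, g(W*) < g(W). -/

import Mathlib

open Matrix

lemma Matrix.sum_sq_sub_entries {ι κ : Type*} [Fintype ι] [Fintype κ] (A B : Matrix ι κ ℝ) :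
    ∑ i, ∑ j, ((A - B) i j) ^ 2 =
      ∑ i, ∑ j, (A i j) ^ 2 - 2 * (Bᵀ * A).trace + ∑ i, ∑ j, (B i j) ^ 2 := by
  have htrace : (Bᵀ * A).trace = ∑ i, ∑ j, B i j * A i j := by
    simp only [trace, diag_apply, mul_apply, transpose_apply]
    exact Finset.sum_comm
  rw [htrace]
  simp only [Finset.mul_sum, ← Finset.sum_sub_distrib, ← Finset.sum_add_distrib, sub_apply]
  refine Finset.sum_congr rfl fun i _ => Finset.sum_congr rfl fun j _ => ?_
  ring

lemma Matrix.sum_sq_entries_nonneg {ι κ : Type*} [Fintype ι] [Fintype κ] (A : Matrix ι κ ℝ) :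
    0 ≤ ∑ i, ∑ j, (A i j) ^ 2 :=
  Finset.sum_nonneg fun _ _ => Finset.sum_nonneg fun _ _ => sq_nonneg _

lemma Matrix.sum_sq_entries_pos {ι κ : Type*} [Fintype ι] [Fintype κ] {A : Matrix ι κ ℝ}
    (hA : A ≠ 0) : 0 < ∑ i, ∑ j, (A i j) ^ 2 := by
  refine (sum_sq_entries_nonneg A).lt_of_ne fun h => hA ?_
  ext i j
  have hi := (Finset.sum_eq_zero_iff_of_nonneg
    fun i _ => Finset.sum_nonneg fun j _ => sq_nonneg (A i j)).mp h.symm i (Finset.mem_univ i)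
  have hij := (Finset.sum_eq_zero_iff_of_nonneg
    fun j _ => sq_nonneg (A i j)).mp hi j (Finset.mem_univ j)
  simpa using hij

lemma Matrix.posDef_smul_one_add_transpose_mul_self {ι κ : Type*} [Fintype ι] [Fintype κ]
    [DecidableEq κ] (X : Matrix ι κ ℝ) {c : ℝ} (hc : 0 < c) :
    (c • (1 : Matrix κ κ ℝ) + Xᵀ * X).PosDef := by
  refine (PosDef.one.smul hc).add_posSemidef ?_
  simpa only [conjTranspose_eq_transpose_of_trivial] using posSemidef_conjTranspose_mul_self X

/-- Closed-form solution of the `W`-subproblem in the ALM algorithm: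
`W* = (3μI + XᵀX)⁻¹ [μ(Z₁+Z₂+Z₃) + (Y₁+Y₂+Y₃) + XᵀX]` is the unique global
minimizer of
`g(W) = (1/2)‖X − XW‖_F² + (μ/2)[‖Z₁ − (W − Y₁/μ)‖_F² + ‖Z₂ − (W − Y₂/μ)‖_F²
+ ‖Z₃ − (W − Y₃/μ)‖_F²]`. -/
theorem W_subproblem_solution (m n : ℕ) (X : Matrix (Fin m) (Fin n) ℝ)
    (Z₁ Z₂ Z₃ Y₁ Y₂ Y₃ : Matrix (Fin n) (Fin n) ℝ) (μ : ℝ) (hμ : 0 < μ)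
    (g : Matrix (Fin n) (Fin n) ℝ → ℝ)
    (hg : ∀ W, g W =
      (1 / 2) * (∑ i, ∑ j, ((X - X * W) i j) ^ 2) +
      (μ / 2) * ((∑ i, ∑ j, ((Z₁ - (W - μ⁻¹ • Y₁)) i j) ^ 2) +
                 (∑ i, ∑ j, ((Z₂ - (W - μ⁻¹ • Y₂)) i j) ^ 2) +
                 (∑ i, ∑ j, ((Z₃ - (W - μ⁻¹ • Y₃)) i j) ^ 2)))
    (Wstar : Matrix (Fin n) (Fin n) ℝ)
    (hWstar : Wstar = ((3 * μ) • (1 : Matrix (Fin n) (Fin n) ℝ) + Xᵀ * X)⁻¹ *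
      (μ • (Z₁ + Z₂ + Z₃) + (Y₁ + Y₂ + Y₃) + Xᵀ * X)) :
    ∀ W : Matrix (Fin n) (Fin n) ℝ, W ≠ Wstar → g Wstar < g W := by
  intro W hW
  have hnormal : ((3 * μ) • (1 : Matrix (Fin n) (Fin n) ℝ) + Xᵀ * X) * Wstar =
      μ • (Z₁ + Z₂ + Z₃) + (Y₁ + Y₂ + Y₃) + Xᵀ * X := by
    have hdet := (isUnit_iff_isUnit_det _).mp
      (posDef_smul_one_add_transpose_mul_self X (c := 3 * μ) (by positivity)).isUnit
    rw [hWstar, mul_nonsing_inv_cancel_left _ _ hdet]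
  have hgradient : Xᵀ * (X - X * Wstar) + μ • ((Z₁ - (Wstar - μ⁻¹ • Y₁)) +
      (Z₂ - (Wstar - μ⁻¹ • Y₂)) + (Z₃ - (Wstar - μ⁻¹ • Y₃))) = 0 := by
    rw [add_mul, smul_mul, one_mul, Matrix.mul_assoc] at hnormal
    simp only [Matrix.mul_sub, smul_add, smul_sub, smul_inv_smul₀ hμ.ne'] at hnormal ⊢
    rw [eq_comm, ← sub_eq_zero] at hnormal
    rw [← hnormal]
    module
  obtain ⟨D, rfl⟩ : ∃ D, W = Wstar + D := ⟨W - Wstar, by abel⟩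
  have hD : D ≠ 0 := fun h => hW (by simp [h])
  have hcross : ((X * D)ᵀ * (X - X * Wstar)).trace +
      μ * ((Dᵀ * (Z₁ - (Wstar - μ⁻¹ • Y₁))).trace + (Dᵀ * (Z₂ - (Wstar - μ⁻¹ • Y₂))).trace +
        (Dᵀ * (Z₃ - (Wstar - μ⁻¹ • Y₃))).trace) = 0 := by
    have h := congrArg (fun M => (Dᵀ * M).trace) hgradient
    simpa only [Matrix.mul_add, Matrix.mul_smul, trace_add, trace_smul, smul_eq_mul,
      Matrix.mul_zero, trace_zero, transpose_mul, Matrix.mul_assoc] using h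
  have hX : X - X * (Wstar + D) = (X - X * Wstar) - X * D := by
    rw [Matrix.mul_add, sub_sub]
  have hZ (Z Y : Matrix (Fin n) (Fin n) ℝ) :
      Z - (Wstar + D - μ⁻¹ • Y) = (Z - (Wstar - μ⁻¹ • Y)) - D := by abel
  rw [hg, hg, hX, hZ, hZ, hZ, sum_sq_sub_entries (X - X * Wstar),
    sum_sq_sub_entries (Z₁ - (Wstar - μ⁻¹ • Y₁)), sum_sq_sub_entries (Z₂ - (Wstar - μ⁻¹ • Y₂)),
    sum_sq_sub_entries (Z₃ - (Wstar - μ⁻¹ • Y₃))]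
  have hXD := sum_sq_entries_nonneg (X * D)
  have hμD := mul_pos hμ (sum_sq_entries_pos hD)
  linarith
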